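/- Let d ≥ 1 and let α, α' ∈ ℝ^d. If α' is a compression of α, then ∑_{1≤i<j≤d} |α'_i − α'_j| < ∑_{1≤i<j≤d} |α_i − α_j|. (Proposition 5.22 of the paper.) -/

import Mathlib

/-- `β` is a *simple compression* of `α`: two entries are moved strictly closer together
while keeping their sum fixed, and all other entries are unchanged. -/
def SimpleCompression {d : ℕ} (α β : Fin d → ℝ) : Prop :=
  ∃ k l : Fin d, k ≠ l ∧ β k + β l = α k + α l ∧ |β k - β l| < |α k - α l| ∧
    ∀ i : Fin d, i ≠ k → i ≠ l → β i = α i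

/-- `α'` is a *compression* of `α`: there is a finite chain `α = α⁽⁰⁾, …, α⁽ᵐ⁾ = α'`
with `m ≥ 1` in which each step is a simple compression. -/
def Compression {d : ℕ} (α α' : Fin d → ℝ) : Prop :=
  Relation.TransGen (fun a b : Fin d → ℝ => SimpleCompression a b) α α'

theorem sum_prod_eq_two_mul_sum_lt {ι : Type*} [Fintype ι] [LinearOrder ι] (f : ι → ι → ℝ)
    (hsymm : ∀ i j, f i j = f j i) (hdiag : ∀ i, f i i = 0) :
    ∑ i, ∑ j, f i j =
      2 * ∑ p ∈ Finset.univ.filter (fun p : ι × ι => p.1 < p.2), f p.1 p.2 := by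
  have hswap : ∑ p : ι × ι, (if p.2 < p.1 then f p.1 p.2 else 0) =
      ∑ p : ι × ι, (if p.1 < p.2 then f p.1 p.2 else 0) :=
    Fintype.sum_equiv (Equiv.prodComm ι ι) _ _ fun p => by
      simp only [Equiv.prodComm_apply, Prod.fst_swap, Prod.snd_swap, hsymm p.1 p.2]
      congr
  rw [Finset.sum_filter, two_mul]
  nth_rewrite 2 [← hswap]
  rw [← Finset.sum_add_distrib, ← Fintype.sum_prod_type']
  refine Finset.sum_congr rfl fun p _ => ?_
  rcases lt_trichotomy p.1 p.2 with h | h | h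
  · simp [h, h.not_gt]
  · simp [h, hdiag]
  · simp [h, h.not_gt]

theorem abs_sub_add_abs_sub_le_of_add_eq {a a' b b' : ℝ} (hsum : b + b' = a + a')
    (hlt : |b - b'| < |a - a'|) (x : ℝ) : |b - x| + |b' - x| ≤ |a - x| + |a' - x| := by
  grind

theorem sum_abs_sub_sub_sum_abs_sub {ι : Type*} [Fintype ι] {α β : ι → ℝ} {k l : ι}
    (hkl : k ≠ l) (heq : ∀ i, i ≠ k → i ≠ l → β i = α i) (x : ℝ) :
    ∑ i, |α i - x| - ∑ i, |β i - x| =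
      (|α k - x| - |β k - x|) + (|α l - x| - |β l - x|) := by
  rw [← Finset.sum_sub_distrib]
  exact Fintype.sum_eq_add k l hkl fun i hi => by simp [heq i hi.1 hi.2]

theorem SimpleCompression.sum_abs_sub_le {d : ℕ} {α β : Fin d → ℝ} (h : SimpleCompression α β)
    (x : ℝ) : ∑ i, |β i - x| ≤ ∑ i, |α i - x| := by
  obtain ⟨k, l, hkl, hsum, hlt, heq⟩ := h
  linarith [sum_abs_sub_sub_sum_abs_sub hkl heq x, abs_sub_add_abs_sub_le_of_add_eq hsum hlt x]

theorem SimpleCompression.exists_sum_abs_sub_lt {d : ℕ} {α β : Fin d → ℝ}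
    (h : SimpleCompression α β) : ∃ j, ∑ i, |β i - β j| < ∑ i, |α i - β j| := by
  obtain ⟨k, l, hkl, hsum, hlt, heq⟩ := h
  refine ⟨k, ?_⟩
  have htri := abs_sub_le (α k) (β k) (α l)
  rw [abs_sub_comm (β k) (α l)] at htri
  rw [abs_sub_comm (β k) (β l)] at hlt
  have hdiff := sum_abs_sub_sub_sum_abs_sub hkl heq (β k)
  rw [sub_self, abs_zero] at hdiff
  linarith

theorem SimpleCompression.sum_sum_abs_sub_lt {d : ℕ} {α β : Fin d → ℝ}
    (h : SimpleCompression α β) : ∑ i, ∑ j, |β i - β j| < ∑ i, ∑ j, |α i - α j| := by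
  obtain ⟨j₀, hj₀⟩ := h.exists_sum_abs_sub_lt
  calc ∑ i, ∑ j, |β i - β j| = ∑ j, ∑ i, |β i - β j| := Finset.sum_comm
    _ < ∑ j, ∑ i, |α i - β j| :=
      Finset.sum_lt_sum (fun j _ => h.sum_abs_sub_le (β j)) ⟨j₀, Finset.mem_univ j₀, hj₀⟩
    _ = ∑ i, ∑ j, |β j - α i| := by
      rw [Finset.sum_comm]
      simp only [abs_sub_comm]
    _ ≤ ∑ i, ∑ j, |α j - α i| := Finset.sum_le_sum fun i _ => h.sum_abs_sub_le (α i)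
    _ = ∑ i, ∑ j, |α i - α j| := Finset.sum_comm

theorem SimpleCompression.sum_lt_abs_sub_lt {d : ℕ} {α β : Fin d → ℝ}
    (h : SimpleCompression α β) :
    ∑ p ∈ Finset.univ.filter (fun p : Fin d × Fin d => p.1 < p.2), |β p.1 - β p.2| <
      ∑ p ∈ Finset.univ.filter (fun p : Fin d × Fin d => p.1 < p.2), |α p.1 - α p.2| := by
  have hβ := sum_prod_eq_two_mul_sum_lt (fun i j => |β i - β j|)
    (fun _ _ => abs_sub_comm _ _) (by simp)
  have hα := sum_prod_eq_two_mul_sum_lt (fun i j => |α i - α j|)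
    (fun _ _ => abs_sub_comm _ _) (by simp)
  linarith [h.sum_sum_abs_sub_lt]

/-- **Proposition 5.22.** If `α'` is a compression of `α ∈ ℝ^d`, then
`∑_{i<j} |α'ᵢ − α'ⱼ| < ∑_{i<j} |αᵢ − αⱼ|`. -/
theorem compression_strictly_decreases_misalignment
    (d : ℕ) (hd : 1 ≤ d) (α α' : Fin d → ℝ) (h : Compression α α') :
    ∑ p ∈ Finset.univ.filter (fun p : Fin d × Fin d => p.1 < p.2), |α' p.1 - α' p.2| <
      ∑ p ∈ Finset.univ.filter (fun p : Fin d × Fin d => p.1 < p.2), |α p.1 - α p.2| := by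
  induction h with
  | single h => exact h.sum_lt_abs_sub_lt
  | tail _ h ih => exact h.sum_lt_abs_sub_lt.trans ih
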